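/- Let N ≥ 2 and let z_{1,N} > z_{2,N} > ... > z_{N,N} be the ordered roots of the Hermite polynomial H_N. Then Σ_{i=1}^N ( Σ_{l ≠ i} 1/(z_{i,N} − z_{l,N})² )² + Σ_{i,l : i ≠ l} 1/(z_{i,N} − z_{l,N})⁴ = N(N−1)(2N−1)/6, where the inner sums over l run over l ≠ i and the double sum runs over all ordered pairs (i,l) with i ≠ l. -/

import Mathlib

/-- The physicists' Hermite polynomials, orthogonal w.r.t. the weight `exp(-x²)` on `ℝ`:
`H_0 = 1`, `H_1 = 2X`, `H_{n+2} = 2X·H_{n+1} - 2(n+1)·H_n`. -/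
noncomputable def hermiteP : ℕ → Polynomial ℝ
  | 0 => 1
  | 1 => 2 * Polynomial.X
  | n + 2 => 2 * Polynomial.X * hermiteP (n + 1) - Polynomial.C (2 * ((n : ℝ) + 1)) * hermiteP n

open Polynomial in
theorem derivative_hermiteP_succ (n : ℕ) :
    derivative (hermiteP (n + 1)) = C (2 * ((n : ℝ) + 1)) * hermiteP n := by
  induction n using Nat.strong_induction_on with
  | _ n ih =>
    match n with
    | 0 => simp [hermiteP, map_ofNat C]
    | 1 =>
      simp [hermiteP, map_ofNat C]
      ring
    | n + 2 =>
      have h1 := ih (n + 1) (by omega)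
      have h0 := ih n (by omega)
      rw [show hermiteP (n + 2 + 1) = 2 * X * hermiteP (n + 2)
        - C (2 * (((n + 1 : ℕ) : ℝ) + 1)) * hermiteP (n + 1) from rfl]
      simp only [derivative_sub, derivative_mul, derivative_C, derivative_X, h1, h0,
        derivative_ofNat]
      rw [show hermiteP (n + 2) = 2 * X * hermiteP (n + 1)
        - C (2 * ((n : ℝ) + 1)) * hermiteP n from rfl]
      simp only [map_add, map_mul, map_one, map_natCast, map_ofNat, Nat.cast_add, Nat.cast_one,
        Nat.cast_ofNat]
      ring

open Polynomial in
/-- Hermite's differential equation. -/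
theorem hermiteP_ode (n : ℕ) :
    derivative (derivative (hermiteP n)) - 2 * X * derivative (hermiteP n)
      + C (2 * (n : ℝ)) * hermiteP n = 0 := by
  match n with
  | 0 => simp [hermiteP]
  | 1 =>
    simp [hermiteP, map_ofNat C]
    ring
  | n + 2 =>
    simp only [derivative_hermiteP_succ (n + 1), derivative_C_mul, derivative_hermiteP_succ n]
    rw [show hermiteP (n + 2) = 2 * X * hermiteP (n + 1)
        - C (2 * ((n : ℝ) + 1)) * hermiteP n from rfl]
    simp only [map_add, map_mul, map_one, map_natCast, map_ofNat, Nat.cast_add, Nat.cast_one,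
      Nat.cast_ofNat]
    ring

theorem hermiteP_ne_zero (n : ℕ) : hermiteP n ≠ 0 := by
  induction n with
  | zero => simp [hermiteP]
  | succ n ih =>
    intro h
    have h' := derivative_hermiteP_succ n
    rw [h, Polynomial.derivative_zero] at h'
    have hc : (2 * ((n : ℝ) + 1)) ≠ 0 := by positivity
    exact mul_ne_zero (Polynomial.C_ne_zero.mpr hc) ih h'.symm

open Polynomial in
theorem natDegree_hermiteP_le (n : ℕ) : (hermiteP n).natDegree ≤ n := by
  induction n using Nat.strong_induction_on with
  | _ n ih =>
    match n with
    | 0 => simp [hermiteP]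
    | 1 =>
      rw [hermiteP]
      compute_degree
    | n + 2 =>
      have h1 := ih (n + 1) (by omega)
      have h0 := ih n (by omega)
      rw [hermiteP]
      refine (natDegree_sub_le _ _).trans (max_le ?_ ?_)
      · refine natDegree_mul_le.trans ?_
        have : (2 * X : ℝ[X]).natDegree ≤ 1 := by compute_degree
        omega
      · exact (natDegree_C_mul_le _ _).trans (by omega)

open Polynomial in
theorem hermiteP_eq_C_mul_prod {N : ℕ} {z : Fin N → ℝ} (hz : Function.Injective z)
    (hroot : ∀ i, (hermiteP N).eval (z i) = 0) :
    ∃ c : ℝ, c ≠ 0 ∧ hermiteP N = C c * ∏ i, (X - C (z i)) := by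
  have hdvd : ∏ i, (X - C (z i)) ∣ hermiteP N :=
    Finset.prod_dvd_of_coprime
      (fun i _ j _ hij => pairwise_coprime_X_sub_C hz hij)
      (fun i _ => dvd_iff_isRoot.mpr (hroot i))
  obtain ⟨R, hR⟩ := hdvd
  have hne := hermiteP_ne_zero N
  have hR0 : R ≠ 0 := by
    rintro rfl
    exact hne (by simpa using hR)
  have hmonic : (∏ i, (X - C (z i))).Monic := monic_prod_X_sub_C z Finset.univ
  have hdeg : (∏ i, (X - C (z i))).natDegree = N := by
    rw [natDegree_finsetProd_X_sub_C_eq_card]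
    simp
  have hRdeg : R.natDegree = 0 := by
    have h := natDegree_hermiteP_le N
    rw [hR, hmonic.natDegree_mul' hR0, hdeg] at h
    omega
  obtain ⟨c, rfl⟩ := natDegree_eq_zero.mp hRdeg
  exact ⟨c, by simpa using hR0, by rw [hR, mul_comm]⟩

open Polynomial in
/-- Derivatives of a monic split polynomial in terms of power sums of inverse distances to its
roots. -/
theorem eval_iterate_derivative_prod_X_sub_C {ι : Type*} [DecidableEq ι] (s : Finset ι)
    (z : ι → ℝ) (a : ℝ) (h : ∀ l ∈ s, a - z l ≠ 0) :
    let Q := ∏ l ∈ s, (X - C (z l))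
    let S := fun k : ℕ => ∑ l ∈ s, ((a - z l) ^ k)⁻¹
    (derivative Q).eval a = Q.eval a * S 1 ∧
    (derivative (derivative Q)).eval a = Q.eval a * (S 1 ^ 2 - S 2) ∧
    (derivative (derivative (derivative Q))).eval a
      = Q.eval a * (S 1 ^ 3 - 3 * S 1 * S 2 + 2 * S 3) ∧
    (derivative (derivative (derivative (derivative Q)))).eval a
      = Q.eval a * (S 1 ^ 4 - 6 * S 1 ^ 2 * S 2 + 8 * S 1 * S 3 + 3 * S 2 ^ 2 - 6 * S 4) := by
  induction s using Finset.induction_on with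
  | empty => simp
  | insert b s hb ih =>
    have hab := h b (Finset.mem_insert_self b s)
    obtain ⟨h1, h2, h3, h4⟩ := ih fun l hl => h l (Finset.mem_insert_of_mem hl)
    simp only [Finset.prod_insert hb, Finset.sum_insert hb, derivative_mul, derivative_sub,
      derivative_X, derivative_C, derivative_add, sub_zero, one_mul, eval_add, eval_mul, eval_sub, eval_X, eval_C, h1, h2, h3, h4]
    refine ⟨?_, ?_, ?_, ?_⟩ <;> field_simp <;> ring

open Polynomial in
/-- Values at a root of `H_N` of the inverse power sums of the distances to the other roots. -/
theorem hermiteP_inverse_power_sums {N : ℕ} {z : Fin N → ℝ} (hz : Function.Injective z)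
    (hroot : ∀ i, (hermiteP N).eval (z i) = 0) (i : Fin N) :
    let S := fun k : ℕ => ∑ l ∈ Finset.univ.erase i, ((z i - z l) ^ k)⁻¹
    S 1 = z i ∧ S 2 = (2 * ((N : ℝ) - 1) - z i ^ 2) / 3 ∧ S 4 = (S 2 ^ 2 + 2 * S 2) / 5 := by
  intro S
  have hsub : ∀ l ∈ Finset.univ.erase i, z i - z l ≠ 0 := fun l hl =>
    sub_ne_zero.mpr fun h => (Finset.ne_of_mem_erase hl) (hz h).symm
  obtain ⟨h1, h2, h3, h4⟩ :=
    eval_iterate_derivative_prod_X_sub_C (Finset.univ.erase i) z (z i) hsub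
  obtain ⟨c, hc, hP⟩ := hermiteP_eq_C_mul_prod hz hroot
  rw [← Finset.mul_prod_erase _ _ (Finset.mem_univ i)] at hP
  set Q := ∏ l ∈ Finset.univ.erase i, (X - C (z l)) with hQ
  have hQ0 : Q.eval (z i) ≠ 0 := by
    rw [hQ, eval_prod]
    exact Finset.prod_ne_zero_iff.mpr fun l hl => by simpa using hsub l hl
  change _ = _ * S 1 at h1
  change _ = _ * (S 1 ^ 2 - S 2) at h2
  change _ = _ * (S 1 ^ 3 - 3 * S 1 * S 2 + 2 * S 3) at h3
  change _ = _ * (S 1 ^ 4 - 6 * S 1 ^ 2 * S 2 + 8 * S 1 * S 3 + 3 * S 2 ^ 2 - 6 * S 4) at h4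
  have ode : derivative (derivative ((X - C (z i)) * Q)) - 2 * X * derivative ((X - C (z i)) * Q)
      + C (2 * (N : ℝ)) * ((X - C (z i)) * Q) = 0 := by
    have h := hermiteP_ode N
    rw [hP] at h
    simp only [derivative_C_mul] at h
    refine (mul_eq_zero.mp ?_).resolve_left (C_ne_zero.mpr hc)
    rw [← h]
    ring
  have e0 := congrArg (eval (z i)) ode
  have e1 := congrArg (fun p => eval (z i) (derivative p)) ode
  have e2 := congrArg (fun p => eval (z i) (derivative (derivative p))) ode
  have e3 := congrArg (fun p => eval (z i) (derivative (derivative (derivative p)))) ode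
  simp only [derivative_mul, derivative_sub, derivative_X, derivative_C, derivative_add,
    derivative_zero, derivative_ofNat, sub_zero, one_mul, zero_mul, zero_add,
    mul_one, mul_zero, add_zero, eval_add, eval_mul, eval_sub, eval_X, eval_C,
    eval_zero, eval_ofNat, sub_self, h1, h2, h3, h4] at e0 e1 e2 e3
  have s1 : S 1 = z i := by
    refine mul_left_cancel₀ hQ0 ?_
    linear_combination e0 / 2
  rw [s1] at e1 e2 e3
  have s2 : S 2 = (2 * ((N : ℝ) - 1) - z i ^ 2) / 3 := by
    refine mul_left_cancel₀ hQ0 ?_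
    linear_combination -e1 / 3
  have hN : (N : ℝ) = (3 * S 2 + z i ^ 2) / 2 + 1 := by
    rw [s2]; ring
  rw [hN] at e2 e3
  have s3 : S 3 = z i / 2 := by
    refine mul_left_cancel₀ hQ0 ?_
    linear_combination e2 / 8
  rw [s3] at e3
  refine ⟨s1, s2, mul_left_cancel₀ hQ0 ?_⟩
  linear_combination -e3 / 30

theorem sum_sum_erase_swap {N : ℕ} (f : Fin N → Fin N → ℝ) :
    ∑ i, ∑ l ∈ Finset.univ.erase i, f i l = ∑ i, ∑ l ∈ Finset.univ.erase i, f l i :=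
  Finset.sum_comm' fun i l => by simp [eq_comm]

theorem sum_mul_inverse_sub_symmetrize {N : ℕ} {z : Fin N → ℝ} (hz : Function.Injective z)
    (h : ∀ i, ∑ l ∈ Finset.univ.erase i, (z i - z l)⁻¹ = z i) (f : ℝ → ℝ) (g : ℝ → ℝ → ℝ)
    (hfg : ∀ x y, f x - f y = (x - y) * g x y) :
    2 * ∑ i, f (z i) * z i = (∑ i, ∑ l, g (z i) (z l)) - ∑ i, g (z i) (z i) := by
  have h1 : ∑ i, f (z i) * z i
      = ∑ i, ∑ l ∈ Finset.univ.erase i, f (z i) * (z i - z l)⁻¹ :=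
    Finset.sum_congr rfl fun i _ => by rw [← Finset.mul_sum, h]
  have h2 := h1.trans (sum_sum_erase_swap _)
  rw [two_mul]
  nth_rewrite 1 [h1]
  rw [h2, ← Finset.sum_add_distrib, ← Finset.sum_sub_distrib]
  refine Finset.sum_congr rfl fun i _ => ?_
  rw [← Finset.sum_add_distrib, ← Finset.sum_erase_eq_sub (Finset.mem_univ i)]
  refine Finset.sum_congr rfl fun l hl => ?_
  have hsub : z i - z l ≠ 0 :=
    sub_ne_zero.mpr fun h => (Finset.ne_of_mem_erase hl) (hz h).symm
  rw [← neg_sub (z i) (z l), inv_neg, mul_neg, ← sub_eq_add_neg, ← sub_mul, hfg]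
  field_simp


/-- For the ordered roots `z 0 > z 1 > … > z (N-1)` of the Hermite
polynomial `H_N` (`N ≥ 2`),
`∑_i (∑_{l ≠ i} 1/(z i - z l)²)² + ∑_{i ≠ l} 1/(z i - z l)⁴ = N(N-1)(2N-1)/6`. -/
theorem hermite_roots_fourth_power_sum_eq
    (N : ℕ) (hN : 2 ≤ N) (z : Fin N → ℝ) (hz : StrictAnti z)
    (hroot : ∀ i, (hermiteP N).eval (z i) = 0) :
    (∑ i, (∑ l ∈ Finset.univ.erase i, ((z i - z l) ^ 2)⁻¹) ^ 2)
        + ∑ i, ∑ l ∈ Finset.univ.erase i, ((z i - z l) ^ 4)⁻¹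
      = (N : ℝ) * ((N : ℝ) - 1) * (2 * (N : ℝ) - 1) / 6 := by
  have key := hermiteP_inverse_power_sums hz.injective hroot
  simp only [pow_one] at key
  have hstieltjes : ∀ i, ∑ l ∈ Finset.univ.erase i, (z i - z l)⁻¹ = z i := fun i => (key i).1
  have hsym := sum_mul_inverse_sub_symmetrize hz.injective hstieltjes
  have m1 := hsym (fun _ => 1) (fun _ _ => 0) (by intros; ring)
  have m2 := hsym (fun x => x) (fun _ _ => 1) (by intros; ring)
  have m4 := hsym (fun x => x ^ 3) (fun x y => x ^ 2 + x * y + y ^ 2) (by intros; ring)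
  have hsum : ∑ i, z i = 0 := by simpa using m1
  have hdiag : ∀ x : ℝ, x ^ 2 + x * x + x ^ 2 = 3 * x ^ 2 := fun x => by ring
  simp only [← sq, Finset.sum_const, Finset.card_univ, Fintype.card_fin,
    nsmul_eq_mul, mul_one] at m2
  simp only [← pow_succ, hdiag, Finset.sum_add_distrib, ← Finset.mul_sum, hsum, mul_zero,
    Finset.sum_const, Finset.card_univ, Fintype.card_fin, nsmul_eq_mul, add_zero,
    Nat.reduceAdd] at m4
  have hterm : ∀ i, (∑ l ∈ Finset.univ.erase i, ((z i - z l) ^ 2)⁻¹) ^ 2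
      + ∑ l ∈ Finset.univ.erase i, ((z i - z l) ^ 4)⁻¹
      = (8 * ((N : ℝ) - 1) ^ 2 + 4 * ((N : ℝ) - 1)) / 15
        - (8 * ((N : ℝ) - 1) + 2) / 15 * z i ^ 2 + 2 / 15 * z i ^ 4 := by
    intro i
    obtain ⟨-, h2, h4⟩ := key i
    rw [h4, h2]
    ring
  rw [← Finset.sum_add_distrib, Finset.sum_congr rfl fun i _ => hterm i]
  simp only [Finset.sum_add_distrib, Finset.sum_sub_distrib, ← Finset.mul_sum, Finset.sum_const,
    Finset.card_univ, Fintype.card_fin, nsmul_eq_mul]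
  linear_combination (-(8 * ((N : ℝ) - 1) + 2) / 30 + (2 * N - 3) / 30) * m2 + m4 / 15
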